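/- arXiv:2511.16488 — 2 statements merged into one kernel-verified Lean document; each statement's English description precedes it below -/
import Mathlib

section
/- Decidability of EN: the set of modal formulas derivable in the logic EN is decidable, i.e., the predicate 'A is derivable in EN' on modal formulas is a decidable predicate. -/
/-- Modal formulas: propositional variables, ⊥, ¬, ∧, ∨, →, □. -/
inductive MF : Type
  | var : ℕ → MF
  | bot : MF
  | neg : MF → MF
  | and : MF → MF → MF
  | or : MF → MF → MF
  | imp : MF → MF → MF
  | box : MF → MF

/-- Defined biconditional A ↔ B := (A → B) ∧ (B → A). -/
def MF.iff (A B : MF) : MF := (A.imp B).and (B.imp A)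

/-- Propositional evaluation: variables and boxed formulas are treated as atoms. -/
def MF.peval (v : MF → Bool) : MF → Bool
  | .var n => v (.var n)
  | .bot => false
  | .neg A => !(A.peval v)
  | .and A B => A.peval v && B.peval v
  | .or A B => A.peval v || B.peval v
  | .imp A B => !(A.peval v) || B.peval v
  | .box A => v A.box

/-- A is a propositional tautology. -/
def MF.Tautology (A : MF) : Prop := ∀ v : MF → Bool, A.peval v = true

/-- The logic EN: propositional tautologies, modus ponens, necessitation, RE. -/
inductive EN : MF → Prop
  | taut {A : MF} : A.Tautology → EN A
  | mp {A B : MF} : EN (A.imp B) → EN A → EN B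
  | nec {A : MF} : EN A → EN A.box
  | re {A B : MF} : EN (A.iff B) → EN (A.box.iff B.box)

/-- An injective Gödel numbering of modal formulas, via the pairing function. -/
def encodeMF : MF → ℕ
  | .var n => Nat.pair 0 n
  | .bot => Nat.pair 1 0
  | .neg A => Nat.pair 2 (encodeMF A)
  | .and A B => Nat.pair 3 (Nat.pair (encodeMF A) (encodeMF B))
  | .or A B => Nat.pair 4 (Nat.pair (encodeMF A) (encodeMF B))
  | .imp A B => Nat.pair 5 (Nat.pair (encodeMF A) (encodeMF B))
  | .box A => Nat.pair 6 (encodeMF A)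

namespace ENdec

/-- Tag of a code. -/
def tg (m : ℕ) : ℕ := m.unpair.1
/-- Argument of a code. -/
def ar (m : ℕ) : ℕ := m.unpair.2
/-- First component of the argument. -/
def a1 (m : ℕ) : ℕ := (ar m).unpair.1
/-- Second component of the argument. -/
def a2 (m : ℕ) : ℕ := (ar m).unpair.2
/-- Bit `i` of `w` is set. -/
def bt (w i : ℕ) : Prop := w / 2 ^ i % 2 = 1

lemma bt_iff (w i : ℕ) : bt w i ↔ w.testBit i = true := by
  simp [bt, Nat.testBit_eq_decide_div_mod_eq]

lemma ar_lt {m : ℕ} (h : tg m ≠ 0) : ar m < m := by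
  have h1 := Nat.pair_unpair m
  have h2 : Nat.pair 0 (ar m) < Nat.pair (tg m) (ar m) :=
    Nat.pair_lt_pair_left _ (Nat.pos_of_ne_zero h)
  have h3 : ar m ≤ Nat.pair 0 (ar m) := Nat.right_le_pair _ _
  unfold ar tg at *
  omega

lemma a1_lt {m : ℕ} (h : tg m ≠ 0) : a1 m < m :=
  lt_of_le_of_lt (Nat.unpair_left_le _) (ar_lt h)
lemma a2_lt {m : ℕ} (h : tg m ≠ 0) : a2 m < m :=
  lt_of_le_of_lt (Nat.unpair_right_le _) (ar_lt h)

/-- Total decoding of natural numbers into formulas. -/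
def dec (m : ℕ) : MF :=
  if h0 : tg m = 0 then .var (ar m)
  else if tg m = 1 then .bot
  else if tg m = 2 then .neg (dec (ar m))
  else if tg m = 3 then .and (dec (a1 m)) (dec (a2 m))
  else if tg m = 4 then .or (dec (a1 m)) (dec (a2 m))
  else if tg m = 5 then .imp (dec (a1 m)) (dec (a2 m))
  else .box (dec (ar m))
termination_by m
decreasing_by all_goals first | exact ar_lt h0 | exact a1_lt h0 | exact a2_lt h0

lemma dec_encode (A : MF) : dec (encodeMF A) = A := by
  induction A <;> rw [dec] <;> simp_all [encodeMF, tg, ar, a1, a2]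

/-- Shape condition for well-formedness certificates. -/
def shape (W m : ℕ) : Prop :=
  tg m = 0 ∨ (tg m = 1 ∧ ar m = 0) ∨ (tg m = 2 ∧ bt W (ar m)) ∨
  ((tg m = 3 ∨ tg m = 4 ∨ tg m = 5) ∧ bt W (a1 m) ∧ bt W (a2 m)) ∨ (tg m = 6 ∧ bt W (ar m))

/-- Well-formedness of a code. -/
def Wf (n : ℕ) : Prop :=
  ∃ W < 2 ^ (n + 1), bt W n ∧ ∀ m < n + 1, (bt W m → shape W m)

lemma exists_bits (N : ℕ) (p : ℕ → Prop) : ∃ W < 2 ^ N, ∀ i < N, (bt W i ↔ p i) := by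
  classical
  refine ⟨Nat.ofBits (fun i : Fin N => decide (p i)), Nat.ofBits_lt_two_pow _, fun i hi => ?_⟩
  rw [bt_iff, Nat.testBit_ofBits_lt _ _ hi]
  simp

lemma pair_eta (m : ℕ) : Nat.pair (tg m) (ar m) = m := Nat.pair_unpair m
lemma pair_eta2 (m : ℕ) : Nat.pair (a1 m) (a2 m) = ar m := Nat.pair_unpair _

lemma wf_iff (n : ℕ) : Wf n ↔ ∃ A, encodeMF A = n := by
  constructor
  · rintro ⟨W, -, hn, hW⟩
    have key : ∀ m, m < n + 1 → bt W m → ∃ A, encodeMF A = m := by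
      intro m
      induction m using Nat.strong_induction_on with
      | _ m ih =>
        intro hm hb
        have e := pair_eta m
        have e2 := pair_eta2 m
        rcases hW m hm hb with h | ⟨h, h'⟩ | ⟨h, h'⟩ | ⟨h, h1, h2⟩ | ⟨h, h'⟩
        · exact ⟨.var (ar m), by rw [encodeMF, ← h, e]⟩
        · exact ⟨.bot, by rw [encodeMF]; rw [h, h'] at e; exact e⟩
        · have hl : ar m < m := ar_lt (by omega)
          obtain ⟨A, hA⟩ := ih _ hl (by omega) h'
          exact ⟨.neg A, by rw [encodeMF, hA, ← h, e]⟩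
        · have hl : a1 m < m := a1_lt (by omega)
          have hl2 : a2 m < m := a2_lt (by omega)
          obtain ⟨A, hA⟩ := ih _ hl (by omega) h1
          obtain ⟨B, hB⟩ := ih _ hl2 (by omega) h2
          rcases h with h | h | h
          · exact ⟨.and A B, by rw [encodeMF, hA, hB, e2, ← h, e]⟩
          · exact ⟨.or A B, by rw [encodeMF, hA, hB, e2, ← h, e]⟩
          · exact ⟨.imp A B, by rw [encodeMF, hA, hB, e2, ← h, e]⟩
        · have hl : ar m < m := ar_lt (by omega)
          obtain ⟨A, hA⟩ := ih _ hl (by omega) h'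
          exact ⟨.box A, by rw [encodeMF, hA, ← h, e]⟩
    exact key n (by omega) hn
  · intro hA
    obtain ⟨W, hW, hb⟩ := exists_bits (n + 1) (fun m => ∃ A, encodeMF A = m)
    refine ⟨W, hW, (hb n (by omega)).2 hA, fun m hm h => ?_⟩
    obtain ⟨A, rfl⟩ := (hb m hm).1 h
    have u1 : tg (encodeMF A) ≠ 0 → bt W (ar (encodeMF A)) ↔
        (tg (encodeMF A) ≠ 0 → ∃ B, encodeMF B = ar (encodeMF A)) := by
      constructor
      · intro H h0; exact (hb _ ((ar_lt h0).trans hm)).1 (H h0)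
      · intro H h0; exact (hb _ ((ar_lt h0).trans hm)).2 (H h0)
    have hr : ∀ h0 : tg (encodeMF A) ≠ 0, (∃ B, encodeMF B = ar (encodeMF A)) →
        bt W (ar (encodeMF A)) := fun h0 => (hb _ ((ar_lt h0).trans hm)).2
    have hr1 : ∀ h0 : tg (encodeMF A) ≠ 0, (∃ B, encodeMF B = a1 (encodeMF A)) →
        bt W (a1 (encodeMF A)) := fun h0 => (hb _ ((a1_lt h0).trans hm)).2
    have hr2 : ∀ h0 : tg (encodeMF A) ≠ 0, (∃ B, encodeMF B = a2 (encodeMF A)) →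
        bt W (a2 (encodeMF A)) := fun h0 => (hb _ ((a2_lt h0).trans hm)).2
    clear u1
    unfold shape
    cases A <;> simp_all [encodeMF, tg, ar, a1, a2]

/-- Local coherence of a truth assignment at code `m`. -/
def coh (w m : ℕ) : Prop :=
  (tg m = 1 → ¬ bt w m) ∧
  (tg m = 2 → (bt w m ↔ ¬ bt w (ar m))) ∧
  (tg m = 3 → (bt w m ↔ (bt w (a1 m) ∧ bt w (a2 m)))) ∧
  (tg m = 4 → (bt w m ↔ (bt w (a1 m) ∨ bt w (a2 m)))) ∧
  (tg m = 5 → (bt w m ↔ (bt w (a1 m) → bt w (a2 m))))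

/-- All worlds of `S` (with bound `K`) agree on `x` and `y`. -/
def agree (K S x y : ℕ) : Prop := ∀ w < K, (bt S w → (bt w x ↔ bt w y))
/-- `x` holds in all worlds of `S`. -/
def full (K S x : ℕ) : Prop := ∀ w < K, (bt S w → bt w x)

/-- `S` is a neighbourhood model for codes up to `n`. -/
def Model (n S : ℕ) : Prop :=
  (∀ w < 2 ^ (n + 1), (bt S w → ∀ m < n + 1, coh w m)) ∧
  (∀ m < n + 1, ∀ m' < n + 1, (6 ≤ tg m → (6 ≤ tg m' →
    (agree (2 ^ (n + 1)) S (ar m) (ar m') → agree (2 ^ (n + 1)) S m m')))) ∧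
  (∀ m < n + 1, (6 ≤ tg m → (full (2 ^ (n + 1)) S (ar m) → full (2 ^ (n + 1)) S m)))

/-- There is a countermodel. -/
def Counter (n : ℕ) : Prop :=
  ∃ S < 2 ^ (2 ^ (n + 1)), Model n S ∧ ¬ full (2 ^ (n + 1)) S n

/-- Truth in the model `S`. -/
def T (n S : ℕ) : MF → ℕ → Prop
  | .var i, w => bt w (Nat.pair 0 i)
  | .bot, _ => False
  | .neg A, w => ¬ T n S A w
  | .and A B, w => T n S A w ∧ T n S B w
  | .or A B, w => T n S A w ∨ T n S B w
  | .imp A B, w => T n S A w → T n S B w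
  | .box A, w => ∀ m < n + 1, 6 ≤ tg m →
      (∀ u < 2 ^ (n + 1), bt S u → (T n S A u ↔ bt u (ar m))) → bt w m

lemma T_dec {n S : ℕ} (hM : Model n S) (m : ℕ) : m < n + 1 → ∀ w < 2 ^ (n + 1), bt S w →
    (T n S (dec m) w ↔ bt w m) := by
  obtain ⟨h1, h2, -⟩ := hM
  induction m using Nat.strong_induction_on with
  | _ m ih =>
    intro hm w hw hS
    have c := h1 w hw hS m hm
    obtain ⟨c1, c2, c3, c4, c5⟩ := c
    by_cases t0 : tg m = 0
    · rw [dec, dif_pos t0, T, ← t0, pair_eta]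
    have l := ar_lt t0
    have l1 := a1_lt t0
    have l2 := a2_lt t0
    have i0 := ih _ l (by omega) w hw hS
    have i1 := ih _ l1 (by omega) w hw hS
    have i2 := ih _ l2 (by omega) w hw hS
    rw [dec, dif_neg t0]
    split_ifs with t1 t2 t3 t4 t5
    · simp [T, c1 t1]
    · rw [T, i0, c2 t2]
    · rw [T, i1, i2, c3 t3]
    · rw [T, i1, i2, c4 t4]
    · rw [T, i1, i2, c5 t5]
    · have t6 : 6 ≤ tg m := by omega
      rw [T]
      constructor
      · intro H
        exact H m hm t6 (fun u hu hSu => ih _ l (by omega) u hu hSu)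
      · intro hb m' hm' t6' H
        refine (h2 m hm m' hm' t6 t6' ?_ w hw hS).1 hb
        intro u hu hSu
        rw [← H u hu hSu, ih _ l (by omega) u hu hSu]

lemma T_peval (n S w : ℕ) (v : MF → Bool) (hv : ∀ A, v A = true ↔ T n S A w) (A : MF) :
    A.peval v = true ↔ T n S A w := by
  induction A with
  | var i => simp [MF.peval, hv]
  | bot => simp [MF.peval, T]
  | neg A ih => simp [MF.peval, T, ← ih]
  | and A B ih1 ih2 => simp [MF.peval, T, ← ih1, ← ih2]
  | or A B ih1 ih2 => simp [MF.peval, T, ← ih1, ← ih2]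
  | imp A B ih1 ih2 =>
    simp only [MF.peval, T, ← ih1, ← ih2]
    cases A.peval v <;> simp
  | box A => simp [MF.peval, hv]

lemma sound {n S : ℕ} (hM : Model n S) {A : MF} (h : EN A) :
    ∀ w < 2 ^ (n + 1), bt S w → T n S A w := by
  classical
  induction h with
  | @taut A h =>
    intro w _ _
    exact (T_peval n S w (fun A => decide (T n S A w)) (by simp) A).1 (h _)
  | mp _ _ ih1 ih2 =>
    intro w hw hS
    exact ih1 w hw hS (ih2 w hw hS)
  | nec _ ih =>
    intro w hw hS
    rw [T]
    intro m hm t6 H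
    exact hM.2.2 m hm t6 (fun u hu hSu => (H u hu hSu).1 (ih u hu hSu)) w hw hS
  | @re A B _ ih =>
    have e : ∀ u < 2 ^ (n + 1), bt S u → (T n S A u ↔ T n S B u) := by
      intro u hu hSu
      have := ih u hu hSu
      simp only [MF.iff, T] at this
      exact ⟨this.1, this.2⟩
    intro w hw hS
    simp only [MF.iff, T]
    refine ⟨fun H m hm t6 H' => H m hm t6 ?_, fun H m hm t6 H' => H m hm t6 ?_⟩
    · intro u hu hSu; rw [e u hu hSu, H' u hu hSu]
    · intro u hu hSu; rw [← e u hu hSu, H' u hu hSu]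

lemma EN_of_list (L : List MF) : ∀ A : MF, (∀ X ∈ L, EN X) →
    (∀ v, (∀ X ∈ L, X.peval v = true) → A.peval v = true) → EN A := by
  induction L with
  | nil => intro A _ h; exact EN.taut (fun v => h v (by simp))
  | cons X L ih =>
    intro A hL h
    refine EN.mp (A := X) (ih _ (fun Y hY => hL Y (by simp [hY])) ?_) (hL X (by simp))
    intro v hv
    rw [MF.peval]
    cases hX : X.peval v
    · simp
    · simp only [Bool.not_true, Bool.false_or]
      exact h v (by simpa [hX] using hv)

/-- Valuations respecting derivable facts about codes up to `n`. -/
def Good (n : ℕ) (v : MF → Bool) : Prop :=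
  ∀ a < n + 1, (EN (dec a) → v (dec a).box = true) ∧
    ∀ b < n + 1, EN ((dec a).iff (dec b)) → v (dec a).box = v (dec b).box

lemma peval_iff (v : MF → Bool) (A B : MF) :
    (A.iff B).peval v = true ↔ A.peval v = B.peval v := by
  simp only [MF.iff, MF.peval]
  cases A.peval v <;> cases B.peval v <;> simp

lemma complete (n : ℕ) (A : MF) (h : ∀ v, Good n v → A.peval v = true) : EN A := by
  classical
  refine EN_of_list
    ((((List.range (n + 1)).map (fun a => (dec a).box)) ++
      ((List.range (n + 1)).flatMap (fun a => (List.range (n + 1)).map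
        (fun b => (dec a).box.iff (dec b).box)))).filter (fun X => decide (EN X))) A ?_ ?_
  · intro X hX
    simpa using (List.mem_filter.1 hX).2
  · intro v hv
    apply h
    intro a ha
    refine ⟨fun hE => ?_, fun b hb hE => ?_⟩
    · have := hv (dec a).box (List.mem_filter.2 ⟨List.mem_append_left _
        (List.mem_map.2 ⟨a, List.mem_range.2 ha, rfl⟩), by simpa using EN.nec hE⟩)
      simpa [MF.peval] using this
    · have := hv ((dec a).box.iff (dec b).box) (List.mem_filter.2 ⟨List.mem_append_right _
        (List.mem_flatMap.2 ⟨a, List.mem_range.2 ha, List.mem_map.2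
          ⟨b, List.mem_range.2 hb, rfl⟩⟩), by simpa using EN.re hE⟩)
      rw [peval_iff] at this
      simpa [MF.peval] using this

lemma counter_of_not (n : ℕ) (h : ¬ EN (dec n)) : Counter n := by
  choose wv hwv hbv using fun v : MF → Bool =>
    exists_bits (n + 1) (fun m => (dec m).peval v = true)
  obtain ⟨S, hS, hb⟩ := exists_bits (2 ^ (n + 1)) (fun w => ∃ v, Good n v ∧ w = wv v)
  have hfull : ∀ m < n + 1, full (2 ^ (n + 1)) S m ↔
      ∀ v, Good n v → (dec m).peval v = true := by
    intro m hm
    constructor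
    · intro H v hv
      exact (hbv v m hm).1 (H (wv v) (hwv v) ((hb _ (hwv v)).2 ⟨v, hv, rfl⟩))
    · intro H w hw hSw
      obtain ⟨v, hv, rfl⟩ := (hb w hw).1 hSw
      exact (hbv v m hm).2 (H v hv)
  have hagree : ∀ m < n + 1, ∀ m' < n + 1, (agree (2 ^ (n + 1)) S m m' ↔
      ∀ v, Good n v → (dec m).peval v = (dec m').peval v) := by
    intro m hm m' hm'
    constructor
    · intro H v hv
      have := H (wv v) (hwv v) ((hb _ (hwv v)).2 ⟨v, hv, rfl⟩)
      rw [hbv v m hm, hbv v m' hm'] at this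
      exact Bool.eq_iff_iff.2 this
    · intro H w hw hSw
      obtain ⟨v, hv, rfl⟩ := (hb w hw).1 hSw
      rw [hbv v m hm, hbv v m' hm', H v hv]
  have hbox : ∀ m, 6 ≤ tg m → dec m = (dec (ar m)).box := by
    intro m t
    rw [dec, dif_neg (by omega), if_neg (by omega), if_neg (by omega), if_neg (by omega),
      if_neg (by omega), if_neg (by omega)]
  refine ⟨S, hS, ⟨?_, ?_, ?_⟩, ?_⟩
  · intro w hw hSw m hm
    obtain ⟨v, hv, rfl⟩ := (hb w hw).1 hSw
    have q : ∀ t0 : tg m ≠ 0,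
        (bt (wv v) (ar m) ↔ (dec (ar m)).peval v = true) ∧
        (bt (wv v) (a1 m) ↔ (dec (a1 m)).peval v = true) ∧
        (bt (wv v) (a2 m) ↔ (dec (a2 m)).peval v = true) := fun t0 =>
      ⟨hbv v _ ((ar_lt t0).trans hm), hbv v _ ((a1_lt t0).trans hm),
        hbv v _ ((a2_lt t0).trans hm)⟩
    unfold coh
    rw [hbv v m hm, dec]
    refine ⟨?_, ?_, ?_, ?_, ?_⟩ <;> intro t <;> obtain ⟨q0, q1, q2⟩ := q (by omega)
    · simp [t, MF.peval]
    · rw [q0]; simp [t, MF.peval]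
    · rw [q1, q2]; simp [t, MF.peval]
    · rw [q1, q2]; simp [t, MF.peval]
    · rw [q1, q2]
      simp only [t, MF.peval]
      cases hh : (dec (a1 m)).peval v <;> simp [MF.peval, hh]
  · intro m hm m' hm' t t' H
    have l := ar_lt (m := m) (by omega)
    have l' := ar_lt (m := m') (by omega)
    rw [hagree _ (by omega) _ (by omega)] at H
    rw [hagree _ (by omega) _ (by omega)]
    have hE : EN ((dec (ar m)).iff (dec (ar m'))) :=
      complete n _ (fun v hv => (peval_iff _ _ _).2 (H v hv))
    intro v hv
    rw [hbox m t, hbox m' t']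
    exact (hv _ (by omega)).2 _ (by omega) hE
  · intro m hm t H
    have l := ar_lt (m := m) (by omega)
    rw [hfull _ (by omega)] at H
    rw [hfull _ (by omega)]
    have hE := complete n _ H
    intro v hv
    rw [hbox m t]
    exact (hv _ (by omega)).1 hE
  · rw [hfull _ (by omega)]
    exact fun H => h (complete n _ H)

lemma EN_dec_iff (n : ℕ) : EN (dec n) ↔ ¬ Counter n := by
  constructor
  · rintro h ⟨S, -, hM, hf⟩
    apply hf
    intro w hw hS
    exact (T_dec hM n (by omega) w hw hS).1 (sound hM h w hw hS)
  · intro h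
    by_contra hn
    exact h (counter_of_not n hn)

section
variable {α : Type} [Primcodable α]

lemma p_all {f : α → ℕ} {R : α → ℕ → Prop} (hf : Primrec f)
    (hR : PrimrecPred fun p : α × ℕ => R p.1 p.2) : PrimrecPred fun a => ∀ x < f a, R a x := by
  have h : PrimrecRel (fun (x : ℕ) (a : α) => R a x) :=
    hR.comp (Primrec.pair Primrec.snd Primrec.fst)
  exact (h.forall_mem_list.comp (Primrec.list_range.comp hf) Primrec.id).of_eq (by simp)

lemma p_ex {f : α → ℕ} {R : α → ℕ → Prop} (hf : Primrec f)
    (hR : PrimrecPred fun p : α × ℕ => R p.1 p.2) : PrimrecPred fun a => ∃ x < f a, R a x := by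
  have h : PrimrecRel (fun (x : ℕ) (a : α) => R a x) :=
    hR.comp (Primrec.pair Primrec.snd Primrec.fst)
  exact (h.exists_mem_list.comp (Primrec.list_range.comp hf) Primrec.id).of_eq (by simp)

lemma p_imp {p q : α → Prop} (hp : PrimrecPred p) (hq : PrimrecPred q) :
    PrimrecPred fun a => (p a → q a) :=
  (hp.not.or hq).of_eq fun a => by tauto

lemma p_iff {p q : α → Prop} (hp : PrimrecPred p) (hq : PrimrecPred q) :
    PrimrecPred fun a => (p a ↔ q a) :=
  ((p_imp hp hq).and (p_imp hq hp)).of_eq fun a => by tauto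

lemma p_pow {f : α → ℕ} (hf : Primrec f) : Primrec fun a => 2 ^ f a := by
  have h : Primrec (fun n : ℕ => 2 ^ n) := by
    refine (Primrec.nat_rec₁ (f := fun _ r => r * 2) 1
      (Primrec.nat_mul.comp Primrec.snd (Primrec.const 2))).of_eq fun n => ?_
    induction n with
    | zero => rfl
    | succ n ih => simp only [pow_succ]; rw [← ih]
  exact h.comp hf

lemma p_bt {f g : α → ℕ} (hf : Primrec f) (hg : Primrec g) :
    PrimrecPred fun a => bt (f a) (g a) :=
  Primrec.eq.comp (Primrec.nat_mod.comp (Primrec.nat_div.comp hf (p_pow hg)) (Primrec.const 2))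
    (Primrec.const 1)

lemma p_tg {f : α → ℕ} (hf : Primrec f) : Primrec fun a => tg (f a) :=
  Primrec.fst.comp (Primrec.unpair.comp hf)
lemma p_ar {f : α → ℕ} (hf : Primrec f) : Primrec fun a => ar (f a) :=
  Primrec.snd.comp (Primrec.unpair.comp hf)
lemma p_a1 {f : α → ℕ} (hf : Primrec f) : Primrec fun a => a1 (f a) :=
  Primrec.fst.comp (Primrec.unpair.comp (p_ar hf))
lemma p_a2 {f : α → ℕ} (hf : Primrec f) : Primrec fun a => a2 (f a) :=
  Primrec.snd.comp (Primrec.unpair.comp (p_ar hf))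
lemma p_tgeq {f : α → ℕ} (hf : Primrec f) (k : ℕ) : PrimrecPred fun a => tg (f a) = k :=
  Primrec.eq.comp (p_tg hf) (Primrec.const k)
lemma p_tgle {f : α → ℕ} (hf : Primrec f) : PrimrecPred fun a => 6 ≤ tg (f a) :=
  Primrec.nat_le.comp (Primrec.const 6) (p_tg hf)

lemma p_shape {f g : α → ℕ} (hf : Primrec f) (hg : Primrec g) :
    PrimrecPred fun a => shape (f a) (g a) :=
  (p_tgeq hg 0).or <| ((p_tgeq hg 1).and (Primrec.eq.comp (p_ar hg) (Primrec.const 0))).or <|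
    ((p_tgeq hg 2).and (p_bt hf (p_ar hg))).or <|
    (((p_tgeq hg 3).or ((p_tgeq hg 4).or (p_tgeq hg 5))).and
      ((p_bt hf (p_a1 hg)).and (p_bt hf (p_a2 hg)))).or <|
    (p_tgeq hg 6).and (p_bt hf (p_ar hg))

lemma p_coh {f g : α → ℕ} (hf : Primrec f) (hg : Primrec g) :
    PrimrecPred fun a => coh (f a) (g a) :=
  (p_imp (p_tgeq hg 1) (p_bt hf hg).not).and <|
  (p_imp (p_tgeq hg 2) (p_iff (p_bt hf hg) (p_bt hf (p_ar hg)).not)).and <|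
  (p_imp (p_tgeq hg 3) (p_iff (p_bt hf hg)
    ((p_bt hf (p_a1 hg)).and (p_bt hf (p_a2 hg))))).and <|
  (p_imp (p_tgeq hg 4) (p_iff (p_bt hf hg)
    ((p_bt hf (p_a1 hg)).or (p_bt hf (p_a2 hg))))).and <|
  (p_imp (p_tgeq hg 5) (p_iff (p_bt hf hg)
    (p_imp (p_bt hf (p_a1 hg)) (p_bt hf (p_a2 hg)))))

lemma p_agree {k s x y : α → ℕ} (hk : Primrec k) (hs : Primrec s) (hx : Primrec x)
    (hy : Primrec y) : PrimrecPred fun a => agree (k a) (s a) (x a) (y a) :=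
  p_all hk <| p_imp (p_bt (hs.comp .fst) .snd)
    (p_iff (p_bt .snd (hx.comp .fst)) (p_bt .snd (hy.comp .fst)))

lemma p_full {k s x : α → ℕ} (hk : Primrec k) (hs : Primrec s) (hx : Primrec x) :
    PrimrecPred fun a => full (k a) (s a) (x a) :=
  p_all hk <| p_imp (p_bt (hs.comp .fst) .snd) (p_bt .snd (hx.comp .fst))

lemma p_model {f s : α → ℕ} (hf : Primrec f) (hs : Primrec s) :
    PrimrecPred fun a => Model (f a) (s a) := by
  have hf1 : Primrec fun a => f a + 1 := Primrec.succ.comp hf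
  have hk : Primrec fun a => 2 ^ (f a + 1) := p_pow hf1
  refine PrimrecPred.and ?_ (PrimrecPred.and ?_ ?_)
  · exact p_all hk <| p_imp (p_bt (hs.comp .fst) .snd) <|
      p_all (hf1.comp .fst) (p_coh (Primrec.snd.comp .fst) .snd)
  · refine p_all hf1 <| p_all (hf1.comp .fst) ?_
    have m1 : Primrec fun p : (α × ℕ) × ℕ => p.1.2 := Primrec.snd.comp .fst
    have m2 : Primrec fun p : (α × ℕ) × ℕ => p.2 := Primrec.snd
    have z : Primrec fun p : (α × ℕ) × ℕ => p.1.1 := Primrec.fst.comp .fst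
    exact p_imp (p_tgle m1) <| p_imp (p_tgle m2) <|
      p_imp (p_agree (hk.comp z) (hs.comp z) (p_ar m1) (p_ar m2))
        (p_agree (hk.comp z) (hs.comp z) m1 m2)
  · exact p_all hf1 <| p_imp (p_tgle .snd) <|
      p_imp (p_full (hk.comp .fst) (hs.comp .fst) (p_ar .snd))
        (p_full (hk.comp .fst) (hs.comp .fst) .snd)
end

lemma p_counter : PrimrecPred Counter := by
  have hk : Primrec fun n : ℕ => 2 ^ (n + 1) := p_pow Primrec.succ
  exact p_ex (p_pow hk) <| (p_model .fst .snd).and (p_full (hk.comp .fst) .snd .fst).not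

lemma p_wf : PrimrecPred Wf := by
  have hk : Primrec fun n : ℕ => 2 ^ (n + 1) := p_pow Primrec.succ
  exact p_ex hk <| (p_bt .snd .fst).and <| p_all (Primrec.succ.comp .fst) <|
    p_imp (p_bt (Primrec.snd.comp .fst) .snd) (p_shape (Primrec.snd.comp .fst) .snd)

end ENdec

/-- Decidability of EN: the set of Gödel numbers of EN-derivable formulas
is a decidable (computable) predicate. -/
theorem EN_decidable :
    ComputablePred (fun n : ℕ => ∃ A : MF, encodeMF A = n ∧ EN A) := by
  refine ((ENdec.p_wf.and ENdec.p_counter.not).of_eq fun n => ?_).computablePred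
  rw [ENdec.wf_iff, ← ENdec.EN_dec_iff]
  constructor
  · rintro ⟨⟨A, rfl⟩, h⟩
    exact ⟨A, rfl, by rwa [ENdec.dec_encode] at h⟩
  · rintro ⟨A, rfl, h⟩
    exact ⟨⟨A, rfl⟩, by rwa [ENdec.dec_encode]⟩
end

section
/- Decidability of ECN: the set of modal formulas derivable in the logic ECN is decidable, i.e., the predicate 'A is derivable in ECN' on modal formulas is a decidable predicate. -/
/-- The logic ECN: EN plus the axiom scheme □A ∧ □B → □(A ∧ B). -/
inductive ECN : MF → Prop
  | taut {A : MF} : A.Tautology → ECN A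
  | axC {A B : MF} : ECN ((A.box.and B.box).imp (A.and B).box)
  | mp {A B : MF} : ECN (A.imp B) → ECN A → ECN B
  | nec {A : MF} : ECN A → ECN A.box
  | re {A B : MF} : ECN (A.iff B) → ECN (A.box.iff B.box)

namespace ECNDec

abbrev bit (x k : ℕ) : Prop := x.testBit k = true

theorem bit_lt {x k : ℕ} (h : bit x k) : k < x :=
  lt_of_lt_of_le Nat.lt_two_pow_self (Nat.ge_two_pow_of_testBit h)

theorem exists_bits (N : ℕ) (p : ℕ → Prop) : ∃ w < 2 ^ N, ∀ i, bit w i ↔ i < N ∧ p i := by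
  classical
  refine ⟨Nat.ofBits (fun i : Fin N => decide (p i)), Nat.ofBits_lt_two_pow _, fun i => ?_⟩
  by_cases h : i < N
  · simp [bit, h]
  · simp [bit, h, Nat.testBit_ofBits_ge _ _ (not_lt.1 h)]

def Hint (v k : ℕ) : Prop :=
  (k.unpair.1 = 1 → ¬ bit v k) ∧
  (k.unpair.1 = 2 → (bit v k ↔ ¬ bit v k.unpair.2)) ∧
  (k.unpair.1 = 3 → (bit v k ↔ (bit v k.unpair.2.unpair.1 ∧ bit v k.unpair.2.unpair.2))) ∧
  (k.unpair.1 = 4 → (bit v k ↔ (bit v k.unpair.2.unpair.1 ∨ bit v k.unpair.2.unpair.2))) ∧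
  (k.unpair.1 = 5 → (bit v k ↔ (bit v k.unpair.2.unpair.1 → bit v k.unpair.2.unpair.2)))

def Good (a W : ℕ) : Prop :=
  (∃ v < W, bit W v ∧ ¬ bit v a) ∧
  ∀ v < W, bit W v → (∀ k < a + 1, Hint v k) ∧
    ∀ c < a + 1, Nat.pair 6 c < a + 1 → ¬ bit v (Nat.pair 6 c) →
      ∃ u < W, bit W u ∧ ¬ bit u c ∧ ∀ b < a + 1, Nat.pair 6 b < a + 1 → bit v (Nat.pair 6 b) →
        (∀ u' < W, bit W u' → bit u' c → bit u' b) → bit u b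

/-! Soundness -/

def sat (a W : ℕ) : MF → ℕ → Prop
  | .var n, w => bit w (Nat.pair 0 n)
  | .bot, _ => False
  | .neg A, w => ¬ sat a W A w
  | .and A B, w => sat a W A w ∧ sat a W B w
  | .or A B, w => sat a W A w ∨ sat a W B w
  | .imp A B, w => sat a W A w → sat a W B w
  | .box A, w => ∃ S : Set ℕ, (∀ b ∈ S, Nat.pair 6 b < a + 1 ∧ bit w (Nat.pair 6 b)) ∧
      ∀ u, bit W u → (sat a W A u ↔ ∀ b ∈ S, bit u b)

open Classical in
theorem peval_sat (a W w : ℕ) (A : MF) :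
    A.peval (fun B => decide (sat a W B w)) = true ↔ sat a W A w := by
  induction A with
  | var n => simp [MF.peval]
  | bot => simp [MF.peval, sat]
  | neg A ih => simp [MF.peval, sat, ← ih]
  | and A B ih1 ih2 => simp [MF.peval, sat, ← ih1, ← ih2]
  | or A B ih1 ih2 => simp [MF.peval, sat, ← ih1, ← ih2]
  | imp A B ih1 ih2 =>
    simp only [MF.peval, sat, ← ih1, ← ih2, Bool.or_eq_true, Bool.not_eq_true', imp_iff_not_or,
      Bool.not_eq_true]
  | box A ih => simp [MF.peval]

theorem sound (a W : ℕ) {A : MF} (h : ECN A) : ∀ w, bit W w → sat a W A w := by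
  classical
  induction h with
  | taut h => intro w _; exact (peval_sat a W w _).1 (h _)
  | axC =>
    rintro w hw ⟨⟨S, hS, hS'⟩, ⟨T, hT, hT'⟩⟩
    refine ⟨S ∪ T, ?_, ?_⟩
    · rintro b (hb | hb)
      exacts [hS b hb, hT b hb]
    · intro u hu
      simp only [sat, hS' u hu, hT' u hu]
      constructor
      · rintro ⟨h1, h2⟩ b (hb | hb)
        exacts [h1 b hb, h2 b hb]
      · intro h
        exact ⟨fun b hb => h b (Or.inl hb), fun b hb => h b (Or.inr hb)⟩
  | mp _ _ ih1 ih2 => intro w hw; exact ih1 w hw (ih2 w hw)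
  | nec _ ih => intro w hw; exact ⟨∅, by simp, fun u hu => by simp [ih u hu]⟩
  | re _ ih =>
    intro w hw
    constructor
    · rintro ⟨S, hS, hS'⟩
      exact ⟨S, hS, fun u hu => by rw [← hS' u hu]; exact ⟨(ih u hu).2, (ih u hu).1⟩⟩
    · rintro ⟨S, hS, hS'⟩
      exact ⟨S, hS, fun u hu => by rw [← hS' u hu]; exact ⟨(ih u hu).1, (ih u hu).2⟩⟩

theorem truth (a W : ℕ) (hG : Good a W) (A : MF) :
    encodeMF A < a + 1 → ∀ w, bit W w → (sat a W A w ↔ bit w (encodeMF A)) := by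
  induction A with
  | var n => intro _ w _; rfl
  | bot =>
    intro h w hw
    have := ((hG.2 w (bit_lt hw) hw).1 _ h).1 (by simp [encodeMF])
    simpa [sat] using this
  | neg A ih =>
    intro h w hw
    have := ((hG.2 w (bit_lt hw) hw).1 _ h).2.1 (by simp [encodeMF])
    rw [this]
    have h1 : encodeMF A < a + 1 := lt_of_le_of_lt (Nat.right_le_pair _ _) h
    simp only [sat, ih h1 w hw, encodeMF, Nat.unpair_pair]
  | and A B ih1 ih2 =>
    intro h w hw
    have := ((hG.2 w (bit_lt hw) hw).1 _ h).2.2.1 (by simp [encodeMF])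
    rw [this]
    have h0 := lt_of_le_of_lt (Nat.right_le_pair _ _) h
    have h1 : encodeMF A < a + 1 := lt_of_le_of_lt (Nat.left_le_pair _ _) h0
    have h2 : encodeMF B < a + 1 := lt_of_le_of_lt (Nat.right_le_pair _ _) h0
    simp only [sat, ih1 h1 w hw, ih2 h2 w hw, encodeMF, Nat.unpair_pair]
  | or A B ih1 ih2 =>
    intro h w hw
    have := ((hG.2 w (bit_lt hw) hw).1 _ h).2.2.2.1 (by simp [encodeMF])
    rw [this]
    have h0 := lt_of_le_of_lt (Nat.right_le_pair _ _) h
    have h1 : encodeMF A < a + 1 := lt_of_le_of_lt (Nat.left_le_pair _ _) h0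
    have h2 : encodeMF B < a + 1 := lt_of_le_of_lt (Nat.right_le_pair _ _) h0
    simp only [sat, ih1 h1 w hw, ih2 h2 w hw, encodeMF, Nat.unpair_pair]
  | imp A B ih1 ih2 =>
    intro h w hw
    have := ((hG.2 w (bit_lt hw) hw).1 _ h).2.2.2.2 (by simp [encodeMF])
    rw [this]
    have h0 := lt_of_le_of_lt (Nat.right_le_pair _ _) h
    have h1 : encodeMF A < a + 1 := lt_of_le_of_lt (Nat.left_le_pair _ _) h0
    have h2 : encodeMF B < a + 1 := lt_of_le_of_lt (Nat.right_le_pair _ _) h0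
    simp only [sat, ih1 h1 w hw, ih2 h2 w hw, encodeMF, Nat.unpair_pair]
  | box A ih =>
    intro h w hw
    have h1 : encodeMF A < a + 1 := lt_of_le_of_lt (Nat.right_le_pair _ _) h
    constructor
    · rintro ⟨S, hS, hS'⟩
      by_contra hc
      obtain ⟨u, -, hu, huc, hub⟩ := (hG.2 w (bit_lt hw) hw).2 _ h1 h hc
      apply huc
      rw [← ih h1 u hu, hS' u hu]
      intro b hb
      refine hub b (lt_of_le_of_lt (Nat.right_le_pair _ _) (hS b hb).1) (hS b hb).1 (hS b hb).2 ?_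
      intro u' _ hu' hc'
      rw [← ih h1 u' hu', hS' u' hu'] at hc'
      exact hc' b hb
    · intro hb
      refine ⟨{encodeMF A}, ?_, ?_⟩
      · rintro b rfl
        exact ⟨h, hb⟩
      · intro u hu
        simp [ih h1 u hu]

theorem not_ECN_of_good {A : MF} {W : ℕ} (hG : Good (encodeMF A) W) : ¬ ECN A := by
  intro h
  obtain ⟨v, -, hv, hva⟩ := hG.1
  exact hva ((truth _ W hG A (Nat.lt_succ_self _) v hv).1 (sound _ W h v hv))

/-! Completeness -/

def Cons (v : MF → Bool) : Prop := ∀ A, ECN A → A.peval v = true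

theorem continuous_peval (A : MF) : Continuous (fun v : MF → Bool => A.peval v) := by
  induction A with
  | var n => exact continuous_apply _
  | bot => exact continuous_const
  | neg A ih => exact (continuous_of_discreteTopology (f := not)).comp ih
  | and A B ih1 ih2 =>
    exact (continuous_of_discreteTopology (f := fun p : Bool × Bool => p.1 && p.2)).comp
      (ih1.prodMk ih2)
  | or A B ih1 ih2 =>
    exact (continuous_of_discreteTopology (f := fun p : Bool × Bool => p.1 || p.2)).comp
      (ih1.prodMk ih2)
  | imp A B ih1 ih2 =>
    exact (continuous_of_discreteTopology (f := fun p : Bool × Bool => !p.1 || p.2)).comp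
      (ih1.prodMk ih2)
  | box A ih => exact continuous_apply _

theorem ECN.and_intro {A B : MF} (hA : ECN A) (hB : ECN B) : ECN (A.and B) := by
  refine .mp (.mp (.taut (A := A.imp (B.imp (A.and B))) ?_) hA) hB
  intro v
  simp only [MF.peval]
  cases A.peval v <;> cases B.peval v <;> rfl

theorem lindenbaum {A : MF} (h : ¬ ECN A) : ∃ v, Cons v ∧ A.peval v = false := by
  let t : {B : MF // ECN B} → Set (MF → Bool) :=
    fun B => {v | B.1.peval v = true ∧ A.peval v = false}
  have hcl : ∀ i, IsClosed (t i) := fun i =>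
    (isClosed_eq (continuous_peval _) continuous_const).inter
      (isClosed_eq (continuous_peval _) continuous_const)
  have : Nonempty {B : MF // ECN B} :=
    ⟨⟨MF.bot.neg, .taut fun v => rfl⟩⟩
  obtain ⟨v, hv⟩ := IsCompact.nonempty_iInter_of_directed_nonempty_isCompact_isClosed t
    (by
      rintro ⟨B, hB⟩ ⟨C, hC⟩
      refine ⟨⟨B.and C, ECN.and_intro hB hC⟩, ?_, ?_⟩
      · rintro v ⟨h1, h2⟩
        simp only [MF.peval, Bool.and_eq_true] at h1
        exact ⟨h1.1, h2⟩
      · rintro v ⟨h1, h2⟩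
        simp only [MF.peval, Bool.and_eq_true] at h1
        exact ⟨h1.2, h2⟩)
    (by
      rintro ⟨B, hB⟩
      by_contra hne
      apply h
      refine .mp (.taut (A := B.imp A) ?_) hB
      intro v
      by_contra hc
      apply hne
      refine ⟨v, ?_⟩
      simpa [MF.peval, t] using hc)
    (fun i => (hcl i).isCompact) hcl
  rw [Set.mem_iInter] at hv
  exact ⟨v, fun B hB => (hv ⟨B, hB⟩).1, (hv this.some).2⟩

theorem ECN_of_cons {A : MF} (h : ∀ v, Cons v → A.peval v = true) : ECN A := by
  by_contra hA
  obtain ⟨v, hv, hf⟩ := lindenbaum hA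
  simp [h v hv] at hf

theorem unpair_right_lt {n : ℕ} (h : n.unpair.1 ≠ 0) : n.unpair.2 < n := by
  have := Nat.unpair_add_le n
  omega

def dec (n : ℕ) : MF :=
  if h0 : n.unpair.1 = 0 then .var n.unpair.2
  else
    have h1 : n.unpair.2 < n := unpair_right_lt h0
    have h2 : n.unpair.2.unpair.1 < n := lt_of_le_of_lt (Nat.unpair_left_le _) h1
    have h3 : n.unpair.2.unpair.2 < n := lt_of_le_of_lt (Nat.unpair_right_le _) h1
    if n.unpair.1 = 2 then .neg (dec n.unpair.2)
    else if n.unpair.1 = 3 then .and (dec n.unpair.2.unpair.1) (dec n.unpair.2.unpair.2)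
    else if n.unpair.1 = 4 then .or (dec n.unpair.2.unpair.1) (dec n.unpair.2.unpair.2)
    else if n.unpair.1 = 5 then .imp (dec n.unpair.2.unpair.1) (dec n.unpair.2.unpair.2)
    else if n.unpair.1 = 6 then .box (dec n.unpair.2)
    else .bot
termination_by n

theorem dec_encode (A : MF) : dec (encodeMF A) = A := by
  induction A with
  | var n => rw [dec]; simp [encodeMF]
  | bot => rw [dec]; simp [encodeMF]
  | neg A ih => rw [dec]; simp [encodeMF, ih]
  | and A B ih1 ih2 => rw [dec]; simp [encodeMF, ih1, ih2]
  | or A B ih1 ih2 => rw [dec]; simp [encodeMF, ih1, ih2]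
  | imp A B ih1 ih2 => rw [dec]; simp [encodeMF, ih1, ih2]
  | box A ih => rw [dec]; simp [encodeMF, ih]

theorem dec_box (c : ℕ) : dec (Nat.pair 6 c) = (dec c).box := by
  rw [dec]; simp

def bigAnd : List MF → MF
  | [] => MF.bot.neg
  | A :: L => A.and (bigAnd L)

theorem peval_bigAnd (v : MF → Bool) (L : List MF) :
    (bigAnd L).peval v = true ↔ ∀ A ∈ L, A.peval v = true := by
  induction L with
  | nil => simp [bigAnd, MF.peval]
  | cons A L ih => simp [bigAnd, MF.peval, ih]

theorem box_bigAnd {v : MF → Bool} (hv : Cons v) (L : List MF)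
    (h : ∀ A ∈ L, v A.box = true) : v (bigAnd L).box = true := by
  induction L with
  | nil => exact hv _ (.nec (.taut fun v => rfl))
  | cons A L ih =>
    have h1 := h A (by simp)
    have h2 := ih fun B hB => h B (by simp [hB])
    have h3 := hv _ (ECN.axC (A := A) (B := bigAnd L))
    simpa [MF.peval, h1, h2, bigAnd] using h3

theorem exists_good {A : MF} (h : ¬ ECN A) :
    ∃ W < 2 ^ (2 ^ (encodeMF A + 1)), Good (encodeMF A) W := by
  classical
  generalize ha : encodeMF A = a
  have key := fun v : MF → Bool => exists_bits (a + 1) (fun k => (dec k).peval v = true)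
  choose cv hcv hbit using key
  obtain ⟨W, hW, hWb⟩ := exists_bits (2 ^ (a + 1)) (fun x => ∃ v, Cons v ∧ x = cv v)
  have hmem : ∀ v, Cons v → bit W (cv v) := fun v hv => (hWb _).2 ⟨hcv v, v, hv, rfl⟩
  refine ⟨W, hW, ?_, ?_⟩
  · obtain ⟨v, hv, hf⟩ := lindenbaum h
    refine ⟨cv v, bit_lt (hmem v hv), hmem v hv, ?_⟩
    rw [hbit]
    subst ha
    simp [dec_encode, hf]
  · intro x _ hx
    obtain ⟨-, v, hv, rfl⟩ := (hWb x).1 hx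
    constructor
    · intro k hk
      have e1 := Nat.unpair_right_le k
      have e2 := Nat.unpair_right_le k.unpair.2
      have e3 := Nat.unpair_left_le k.unpair.2
      have l1 : k.unpair.2 < a + 1 := by omega
      have l2 : k.unpair.2.unpair.1 < a + 1 := by omega
      have l3 : k.unpair.2.unpair.2 < a + 1 := by omega
      refine ⟨?_, ?_, ?_, ?_, ?_⟩ <;> intro ht <;> simp only [hbit, hk, l1, l2, l3, true_and] <;>
        rw [dec] <;> simp [ht, MF.peval, imp_iff_not_or]
    · intro c hc hc6 hcv6
      by_contra hcon
      apply hcv6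
      rw [hbit]
      refine ⟨hc6, ?_⟩
      rw [dec_box]
      let P : ℕ → Prop := fun b => Nat.pair 6 b < a + 1 ∧ v (dec b).box = true ∧
        ∀ u, Cons u → (dec c).peval u = true → (dec b).peval u = true
      let L : List MF := ((List.range (a + 1)).filter (fun b => decide (P b))).map dec
      have hL : ∀ B ∈ L, ∃ b, P b ∧ dec b = B := by
        intro B hB
        simp only [L, List.mem_map, List.mem_filter, decide_eq_true_eq] at hB
        obtain ⟨b, ⟨-, hb⟩, e⟩ := hB
        exact ⟨b, hb, e⟩
      have hE : ECN ((bigAnd L).iff (dec c)) := by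
        apply ECN_of_cons
        intro u hu
        have d1 : (bigAnd L).peval u = true → (dec c).peval u = true := by
          intro hb
          rw [peval_bigAnd] at hb
          by_contra hcu
          apply hcon
          refine ⟨cv u, bit_lt (hmem u hu), hmem u hu, ?_, ?_⟩
          · rw [hbit]; exact fun h => hcu h.2
          · intro b hba hb6 hvb hall
            rw [hbit]
            refine ⟨hba, hb _ ?_⟩
            simp only [L, List.mem_map, List.mem_filter, decide_eq_true_eq, List.mem_range]
            refine ⟨b, ⟨hba, hb6, ?_, ?_⟩, rfl⟩
            · rw [hbit, dec_box] at hvb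
              exact hvb.2
            · intro u' hu' hcu'
              have := hall (cv u') (bit_lt (hmem u' hu')) (hmem u' hu') ((hbit _ _).2 ⟨hc, hcu'⟩)
              exact ((hbit _ _).1 this).2
        have d2 : (dec c).peval u = true → (bigAnd L).peval u = true := by
          intro hcu
          rw [peval_bigAnd]
          intro B hB
          obtain ⟨b, hb, rfl⟩ := hL B hB
          exact hb.2.2 u hu hcu
        simp only [MF.iff, MF.peval]
        revert d1 d2
        cases (bigAnd L).peval u <;> cases (dec c).peval u <;> simp
      have hbox := hv _ (ECN.re hE)
      have hS := box_bigAnd hv L (by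
        intro B hB
        obtain ⟨b, hb, rfl⟩ := hL B hB
        exact hb.2.1)
      simpa [MF.iff, MF.peval, hS] using hbox

/-! Valid codes -/

def VLoc (u k : ℕ) : Prop :=
  k.unpair.1 < 7 ∧
  (k.unpair.1 = 1 → k.unpair.2 = 0) ∧
  (k.unpair.1 = 2 → bit u k.unpair.2) ∧
  (k.unpair.1 = 3 → bit u k.unpair.2.unpair.1 ∧ bit u k.unpair.2.unpair.2) ∧
  (k.unpair.1 = 4 → bit u k.unpair.2.unpair.1 ∧ bit u k.unpair.2.unpair.2) ∧
  (k.unpair.1 = 5 → bit u k.unpair.2.unpair.1 ∧ bit u k.unpair.2.unpair.2) ∧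
  (k.unpair.1 = 6 → bit u k.unpair.2)

def Valid (n : ℕ) : Prop :=
  ∃ u < 2 ^ (n + 1), bit u n ∧ ∀ k < u, bit u k → VLoc u k

theorem valid_of_bit {u : ℕ} (h : ∀ k < u, bit u k → VLoc u k) (k : ℕ) :
    bit u k → ∃ A, encodeMF A = k := by
  induction k using Nat.strong_induction_on with
  | _ k ih =>
    intro hk
    obtain ⟨h7, h1, h2, h3, h4, h5, h6⟩ := h k (bit_lt hk) hk
    have hp := Nat.pair_unpair k
    have hp2 := Nat.pair_unpair k.unpair.2
    by_cases h0 : k.unpair.1 = 0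
    · exact ⟨.var k.unpair.2, by rw [encodeMF, ← h0, hp]⟩
    have l1 := unpair_right_lt h0
    have l2 := lt_of_le_of_lt (Nat.unpair_left_le k.unpair.2) l1
    have l3 := lt_of_le_of_lt (Nat.unpair_right_le k.unpair.2) l1
    have hcases : k.unpair.1 = 1 ∨ k.unpair.1 = 2 ∨ k.unpair.1 = 3 ∨ k.unpair.1 = 4 ∨
      k.unpair.1 = 5 ∨ k.unpair.1 = 6 := by omega
    rcases hcases with e | e | e | e | e | e
    · exact ⟨.bot, by rw [encodeMF, ← e, ← h1 e, hp]⟩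
    · obtain ⟨A, hA⟩ := ih _ l1 (h2 e)
      exact ⟨.neg A, by rw [encodeMF, hA, ← e, hp]⟩
    · obtain ⟨A, hA⟩ := ih _ l2 (h3 e).1
      obtain ⟨B, hB⟩ := ih _ l3 (h3 e).2
      exact ⟨.and A B, by rw [encodeMF, hA, hB, hp2, ← e, hp]⟩
    · obtain ⟨A, hA⟩ := ih _ l2 (h4 e).1
      obtain ⟨B, hB⟩ := ih _ l3 (h4 e).2
      exact ⟨.or A B, by rw [encodeMF, hA, hB, hp2, ← e, hp]⟩
    · obtain ⟨A, hA⟩ := ih _ l2 (h5 e).1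
      obtain ⟨B, hB⟩ := ih _ l3 (h5 e).2
      exact ⟨.imp A B, by rw [encodeMF, hA, hB, hp2, ← e, hp]⟩
    · obtain ⟨A, hA⟩ := ih _ l1 (h6 e)
      exact ⟨.box A, by rw [encodeMF, hA, ← e, hp]⟩

theorem valid_iff (n : ℕ) : Valid n ↔ ∃ A, encodeMF A = n := by
  constructor
  · rintro ⟨u, -, hn, h⟩
    exact valid_of_bit h n hn
  · rintro ⟨A, rfl⟩
    generalize ha : encodeMF A = a
    obtain ⟨u, hu, hb⟩ := exists_bits (a + 1) (fun k => ∃ A, encodeMF A = k)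
    refine ⟨u, hu, (hb a).2 ⟨Nat.lt_succ_self a, A, ha⟩, ?_⟩
    intro k _ hk
    obtain ⟨hka, B, rfl⟩ := (hb k).1 hk
    have e1 := Nat.unpair_right_le (encodeMF B)
    have e2 := Nat.unpair_right_le (encodeMF B).unpair.2
    have e3 := Nat.unpair_left_le (encodeMF B).unpair.2
    have l1 : (encodeMF B).unpair.2 < a + 1 := by omega
    have l2 : (encodeMF B).unpair.2.unpair.1 < a + 1 := by omega
    have l3 : (encodeMF B).unpair.2.unpair.2 < a + 1 := by omega
    unfold VLoc
    simp only [hb, l1, l2, l3, true_and]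
    cases B <;> simp [encodeMF]

theorem main_iff (n : ℕ) : (Valid n ∧ ¬ ∃ W < 2 ^ (2 ^ (n + 1)), Good n W) ↔
    ∃ A : MF, encodeMF A = n ∧ ECN A := by
  rw [valid_iff]
  constructor
  · rintro ⟨⟨A, rfl⟩, h⟩
    refine ⟨A, rfl, ?_⟩
    by_contra hA
    exact h (exists_good hA)
  · rintro ⟨A, rfl, hA⟩
    exact ⟨⟨A, rfl⟩, fun ⟨W, _, hG⟩ => not_ECN_of_good hG hA⟩

/-! Primitive recursiveness -/

section prim
variable {α : Type} [Primcodable α]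

theorem pimp {p q : α → Prop} (hp : PrimrecPred p) (hq : PrimrecPred q) :
    PrimrecPred fun x => p x → q x :=
  (hp.not.or hq).of_eq fun _ => imp_iff_not_or.symm

theorem piff {p q : α → Prop} (hp : PrimrecPred p) (hq : PrimrecPred q) :
    PrimrecPred fun x => p x ↔ q x :=
  ((pimp hp hq).and (pimp hq hp)).of_eq fun _ => iff_iff_implies_and_implies.symm

theorem pall {f : α → ℕ} {p : α → ℕ → Prop} (hf : Primrec f)
    (hp : PrimrecPred fun y : α × ℕ => p y.1 y.2) : PrimrecPred fun x => ∀ k < f x, p x k := by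
  have h1 : PrimrecRel fun (k : ℕ) (x : α) => p x k :=
    hp.comp (Primrec.snd.pair Primrec.fst)
  have h2 := h1.forall_mem_list
  exact (h2.comp (Primrec.list_range.comp hf) Primrec.id).of_eq fun x => by simp

theorem pex {f : α → ℕ} {p : α → ℕ → Prop} (hf : Primrec f)
    (hp : PrimrecPred fun y : α × ℕ => p y.1 y.2) : PrimrecPred fun x => ∃ k < f x, p x k := by
  have h1 : PrimrecRel fun (k : ℕ) (x : α) => p x k :=
    hp.comp (Primrec.snd.pair Primrec.fst)
  have h2 := h1.exists_mem_list
  exact (h2.comp (Primrec.list_range.comp hf) Primrec.id).of_eq fun x => by simp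

theorem ppow {f : α → ℕ} (hf : Primrec f) : Primrec fun x => 2 ^ f x := by
  have h : Primrec fun n : ℕ => 2 ^ n := by
    refine (Primrec.nat_rec₁ (f := fun _ r => 2 * r) 1
      ((Primrec.nat_mul.comp (Primrec.const 2) Primrec.snd).to₂)).of_eq fun n => ?_
    induction n with
    | zero => rfl
    | succ n ih => simp only [pow_succ]; rw [← ih]; ring
  exact h.comp hf

theorem pbit {f g : α → ℕ} (hf : Primrec f) (hg : Primrec g) :
    PrimrecPred fun x => bit (f x) (g x) := by
  refine (Primrec.eq.comp (Primrec.nat_mod.comp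
    (Primrec.nat_div.comp hf (ppow hg)) (Primrec.const 2)) (Primrec.const 1)).of_eq fun x => ?_
  simp [bit, Nat.testBit_eq_decide_div_mod_eq]

theorem plt {f g : α → ℕ} (hf : Primrec f) (hg : Primrec g) :
    PrimrecPred fun x => f x < g x := Primrec.nat_lt.comp hf hg

theorem peqc {f : α → ℕ} (hf : Primrec f) (c : ℕ) :
    PrimrecPred fun x => f x = c := Primrec.eq.comp hf (Primrec.const c)

theorem pu1 {f : α → ℕ} (hf : Primrec f) : Primrec fun x => (f x).unpair.1 :=
  Primrec.fst.comp (Primrec.unpair.comp hf)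

theorem pu2 {f : α → ℕ} (hf : Primrec f) : Primrec fun x => (f x).unpair.2 :=
  Primrec.snd.comp (Primrec.unpair.comp hf)

theorem pp6 {f : α → ℕ} (hf : Primrec f) : Primrec fun x => Nat.pair 6 (f x) :=
  Primrec₂.natPair.comp (Primrec.const 6) hf

theorem phint {f g : α → ℕ} (hf : Primrec f) (hg : Primrec g) :
    PrimrecPred fun x => Hint (f x) (g x) := by
  have t := pu1 hg
  have m := pu2 hg
  have b := pbit hf hg
  have b0 := pbit hf m
  have b1 := pbit hf (pu1 m)
  have b2 := pbit hf (pu2 m)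
  exact (pimp (peqc t 1) b.not).and <| (pimp (peqc t 2) (piff b b0.not)).and <|
    (pimp (peqc t 3) (piff b (b1.and b2))).and <| (pimp (peqc t 4) (piff b (b1.or b2))).and <|
    (pimp (peqc t 5) (piff b (pimp b1 b2)))

theorem pvloc {f g : α → ℕ} (hf : Primrec f) (hg : Primrec g) :
    PrimrecPred fun x => VLoc (f x) (g x) := by
  have t := pu1 hg
  have m := pu2 hg
  have b0 := pbit hf m
  have b1 := pbit hf (pu1 m)
  have b2 := pbit hf (pu2 m)
  exact (plt t (Primrec.const 7)).and <| (pimp (peqc t 1) (peqc m 0)).and <|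
    (pimp (peqc t 2) b0).and <|
    (pimp (peqc t 3) (b1.and b2)).and <| (pimp (peqc t 4) (b1.and b2)).and <|
    (pimp (peqc t 5) (b1.and b2)).and <| (pimp (peqc t 6) b0)

def Q1 (W c b : ℕ) : Prop := ∀ u' < W, bit W u' → bit u' c → bit u' b

def Q2 (a W v c u : ℕ) : Prop :=
  ∀ b < a + 1, Nat.pair 6 b < a + 1 → bit v (Nat.pair 6 b) → Q1 W c b → bit u b

def Q3 (a W v c : ℕ) : Prop := ∃ u < W, bit W u ∧ ¬ bit u c ∧ Q2 a W v c u

def Q4 (a W v : ℕ) : Prop :=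
  ∀ c < a + 1, Nat.pair 6 c < a + 1 → ¬ bit v (Nat.pair 6 c) → Q3 a W v c

theorem plift {h : α → ℕ} (hh : Primrec h) : Primrec fun y : α × ℕ => h y.1 :=
  hh.comp Primrec.fst

theorem psnd : Primrec fun y : α × ℕ => y.2 := Primrec.snd

theorem psucc {h : α → ℕ} (hh : Primrec h) : Primrec fun y => h y + 1 :=
  Primrec.succ.comp hh

theorem pq1 {W c b : α → ℕ} (hW : Primrec W) (hc : Primrec c) (hb : Primrec b) :
    PrimrecPred fun x => Q1 (W x) (c x) (b x) := by
  unfold Q1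
  exact pall hW (pimp (pbit (plift hW) psnd) (pimp (pbit psnd (plift hc)) (pbit psnd (plift hb))))

theorem pq2 {a W v c u : α → ℕ} (ha : Primrec a) (hW : Primrec W) (hv : Primrec v)
    (hc : Primrec c) (hu : Primrec u) :
    PrimrecPred fun x => Q2 (a x) (W x) (v x) (c x) (u x) := by
  unfold Q2
  exact pall (psucc ha) (pimp (plt (pp6 psnd) (plift (psucc ha)))
    (pimp (pbit (plift hv) (pp6 psnd))
      (pimp (pq1 (plift hW) (plift hc) psnd) (pbit (plift hu) psnd))))

theorem pq3 {a W v c : α → ℕ} (ha : Primrec a) (hW : Primrec W) (hv : Primrec v)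
    (hc : Primrec c) :
    PrimrecPred fun x => Q3 (a x) (W x) (v x) (c x) := by
  unfold Q3
  exact pex hW ((pbit (plift hW) psnd).and ((pbit psnd (plift hc)).not.and
    (pq2 (plift ha) (plift hW) (plift hv) (plift hc) psnd)))

theorem pq4 {a W v : α → ℕ} (ha : Primrec a) (hW : Primrec W) (hv : Primrec v) :
    PrimrecPred fun x => Q4 (a x) (W x) (v x) := by
  unfold Q4
  exact pall (psucc ha) (pimp (plt (pp6 psnd) (plift (psucc ha)))
    (pimp (pbit (plift hv) (pp6 psnd)).not
      (pq3 (plift ha) (plift hW) (plift hv) psnd)))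

theorem good_iff (a W : ℕ) : Good a W ↔ ((∃ v < W, bit W v ∧ ¬ bit v a) ∧
    ∀ v < W, bit W v → (∀ k < a + 1, Hint v k) ∧ Q4 a W v) := Iff.rfl

theorem pgood {f g : α → ℕ} (hf : Primrec f) (hg : Primrec g) :
    PrimrecPred fun x => Good (f x) (g x) := by
  simp only [good_iff]
  exact PrimrecPred.and (pex hg ((pbit (plift hg) psnd).and (pbit psnd (plift hf)).not))
    (pall hg (pimp (pbit (plift hg) psnd) (PrimrecPred.and
      (pall (plift (psucc hf)) (phint (plift psnd) psnd))
      (pq4 (plift hf) (plift hg) psnd))))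

end prim

theorem pmain : PrimrecPred fun n : ℕ => Valid n ∧ ¬ ∃ W < 2 ^ (2 ^ (n + 1)), Good n W := by
  refine PrimrecPred.and ?_ (PrimrecPred.not ?_)
  · refine pex (ppow Primrec.succ) (PrimrecPred.and (pbit .snd .fst) ?_)
    exact pall .snd (pimp (pbit (Primrec.snd.comp .fst) .snd) (pvloc (Primrec.snd.comp .fst) .snd))
  · exact pex (ppow (ppow Primrec.succ)) (pgood .fst .snd)

end ECNDec

/-- Decidability of ECN: the set of Gödel numbers of ECN-derivable formulas
is a decidable (computable) predicate. -/
theorem ECN_decidable :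
    ComputablePred (fun n : ℕ => ∃ A : MF, encodeMF A = n ∧ ECN A) := 
  ECNDec.pmain.computablePred.of_eq ECNDec.main_iff
end
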